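/- arXiv:2207.03176 — 2 statements merged into one kernel-verified Lean document; each statement's English description precedes it below -/
import Mathlib

section
/- Let a₀ < b₀ be real numbers, let 𝔄 ≥ 0 be a constant, let 𝔅, ℭ, 𝔉 : [a₀,b₀] → ℝ be nonnegative continuous functions, and let 0 < γ₀ < 1. If 𝔉(t) ≤ 𝔄 + ∫_{a₀}^t (𝔅(s)𝔉(s) + ℭ(s)𝔉(s)^{γ₀}) ds for all t ∈ [a₀,b₀], then for all t ∈ [a₀,b₀] one has 𝔉(t) ≤ ( 𝔄^{1-γ₀} · exp((1-γ₀)∫_{a₀}^t 𝔅(τ) dτ) + (1-γ₀) ∫_{a₀}^t ℭ(τ) · exp((1-γ₀)∫_{τ}^t 𝔅(s) ds) dτ )^{1/(1-γ₀)}. -/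
open MeasureTheory intervalIntegral

/-- Perov's inequality with a positive constant, for functions continuous on the whole line. -/
lemma perov_sublinear_of_continuous_of_pos {a b A γ : ℝ} (hA : 0 < A) (hγ₀ : 0 < γ) (hγ₁ : γ < 1)
    {B C F : ℝ → ℝ} (hBc : Continuous B) (hCc : Continuous C) (hFc : Continuous F)
    (hB : ∀ t, 0 ≤ B t) (hC : ∀ t, 0 ≤ C t) (hF : ∀ t, 0 ≤ F t)
    (hle : ∀ t ∈ Set.Icc a b, F t ≤ A + ∫ s in a..t, (B s * F s + C s * F s ^ γ))
    {t : ℝ} (ht : t ∈ Set.Icc a b) :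
    F t ≤ (A ^ (1 - γ) * Real.exp ((1 - γ) * ∫ τ in a..t, B τ)
        + (1 - γ) * ∫ τ in a..t, C τ * Real.exp ((1 - γ) * ∫ s in τ..t, B s))
          ^ (1 / (1 - γ)) := by
  have hp : 0 < 1 - γ := sub_pos.2 hγ₁
  have hHc : Continuous fun s ↦ B s * F s + C s * F s ^ γ :=
    (hBc.mul hFc).add (hCc.mul (hFc.rpow_const fun _ ↦ Or.inr hγ₀.le))
  set V : ℝ → ℝ := fun t ↦ A + ∫ s in a..t, (B s * F s + C s * F s ^ γ) with hV
  set β : ℝ → ℝ := fun t ↦ ∫ τ in a..t, B τ with hβ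
  have hVd (x : ℝ) : HasDerivAt V (B x * F x + C x * F x ^ γ) x :=
    (hHc.integral_hasStrictDerivAt a x).hasDerivAt.const_add A
  have hβd (x : ℝ) : HasDerivAt β (B x) x := (hBc.integral_hasStrictDerivAt a x).hasDerivAt
  have hβc : Continuous β := continuous_iff_continuousAt.2 fun x ↦ (hβd x).continuousAt
  have hEc : Continuous fun x ↦ C x * Real.exp (-((1 - γ) * β x)) := by fun_prop
  have hVpos (x : ℝ) (hx : a ≤ x) : 0 < V x :=
    add_pos_of_pos_of_nonneg hA <| integral_nonneg hx fun s _ ↦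
      add_nonneg (mul_nonneg (hB s) (hF s)) (mul_nonneg (hC s) (Real.rpow_nonneg (hF s) _))
  set G : ℝ → ℝ := fun x ↦ V x ^ (1 - γ) * Real.exp (-((1 - γ) * β x))
    - (1 - γ) * ∫ τ in a..x, C τ * Real.exp (-((1 - γ) * β τ)) with hG
  have hGd (x : ℝ) (hx : a ≤ x) :=
    (((hVd x).rpow_const (p := 1 - γ) (Or.inl (hVpos x hx).ne')).mul
      (((hβd x).const_mul (1 - γ)).neg.exp)).sub
      ((hEc.integral_hasStrictDerivAt a x).hasDerivAt.const_mul (1 - γ))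
  have hanti : AntitoneOn G (Set.Icc a b) := by
    refine antitoneOn_of_hasDerivWithinAt_nonpos (convex_Icc a b)
      (fun x hx ↦ (hGd x hx.1).continuousAt.continuousWithinAt)
      (fun x hx ↦ (hGd x (interior_subset hx).1).hasDerivWithinAt) fun x hx ↦ ?_
    have hx' := interior_subset hx
    have hFV : F x ≤ V x := hle x hx'
    have hv := hVpos x hx'.1
    have h₁ : V x ^ (1 - γ - 1) * V x ^ γ = 1 := by
      rw [← Real.rpow_add hv]; simp
    have h₂ : V x ^ (1 - γ - 1) * V x = V x ^ (1 - γ) := by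
      rw [← Real.rpow_add_one hv.ne', sub_add_cancel]
    have h₃ : (B x * F x + C x * F x ^ γ) * V x ^ (1 - γ - 1) ≤ B x * V x ^ (1 - γ) + C x :=
      calc _ ≤ (B x * V x + C x * V x ^ γ) * V x ^ (1 - γ - 1) := by
            gcongr
            · exact hB x
            · exact hC x
            · exact hF x
        _ = B x * (V x ^ (1 - γ - 1) * V x) + C x * (V x ^ (1 - γ - 1) * V x ^ γ) := by ring
        _ = _ := by rw [h₁, h₂, mul_one]
    have h₄ := mul_le_mul_of_nonneg_left h₃
      (mul_nonneg hp.le (Real.exp_pos (-((1 - γ) * β x))).le)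
    simp only [Pi.neg_apply]
    linarith
  have hGt : G t ≤ A ^ (1 - γ) := by
    have := hanti ⟨le_rfl, ht.1.trans ht.2⟩ ht ht.1
    simpa [hG, hV, hβ] using this
  have hint : ∫ τ in a..t, C τ * Real.exp ((1 - γ) * ∫ s in τ..t, B s)
      = Real.exp ((1 - γ) * β t) * ∫ τ in a..t, C τ * Real.exp (-((1 - γ) * β τ)) := by
    rw [← intervalIntegral.integral_const_mul]
    refine integral_congr fun τ _ ↦ ?_
    have : ∫ s in τ..t, B s = β t - β τ :=
      (integral_interval_sub_left (hBc.intervalIntegrable _ _) (hBc.intervalIntegrable _ _)).symm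
    simp only [this]
    rw [mul_sub, sub_eq_add_neg, Real.exp_add]
    ring
  have hW : V t ^ (1 - γ) ≤ A ^ (1 - γ) * Real.exp ((1 - γ) * β t)
      + (1 - γ) * ∫ τ in a..t, C τ * Real.exp ((1 - γ) * ∫ s in τ..t, B s) := by
    rw [hint]
    have h := mul_le_mul_of_nonneg_right hGt (Real.exp_pos ((1 - γ) * β t)).le
    have he : Real.exp (-((1 - γ) * β t)) * Real.exp ((1 - γ) * β t) = 1 := by
      rw [← Real.exp_add]; simp
    simp only [hG, sub_mul (_ * _) (_ * _) (Real.exp _), mul_assoc (V t ^ (1 - γ)), he] at h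
    linarith
  calc F t ≤ V t := hle t ht
    _ = (V t ^ (1 - γ)) ^ (1 / (1 - γ)) := by
      rw [← Real.rpow_mul (hVpos t ht.1).le, mul_one_div_cancel hp.ne', Real.rpow_one]
    _ ≤ _ := Real.rpow_le_rpow (Real.rpow_nonneg (hVpos t ht.1).le _) hW (by positivity)

/-- Perov's generalization of the Gronwall lemma, sublinear case `0 < γ₀ < 1`. -/
theorem perov_gronwall_sublinear
    (a₀ b₀ : ℝ) (hab : a₀ < b₀)
    (A γ₀ : ℝ) (hA : 0 ≤ A) (hγ₀ : 0 < γ₀) (hγ₁ : γ₀ < 1)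
    (B C F : ℝ → ℝ)
    (hBc : ContinuousOn B (Set.Icc a₀ b₀))
    (hCc : ContinuousOn C (Set.Icc a₀ b₀))
    (hFc : ContinuousOn F (Set.Icc a₀ b₀))
    (hBnn : ∀ t ∈ Set.Icc a₀ b₀, 0 ≤ B t)
    (hCnn : ∀ t ∈ Set.Icc a₀ b₀, 0 ≤ C t)
    (hFnn : ∀ t ∈ Set.Icc a₀ b₀, 0 ≤ F t)
    (hineq : ∀ t ∈ Set.Icc a₀ b₀,
      F t ≤ A + ∫ s in a₀..t, (B s * F s + C s * F s ^ γ₀)) :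
    ∀ t ∈ Set.Icc a₀ b₀,
      F t ≤ (A ^ (1 - γ₀) * Real.exp ((1 - γ₀) * ∫ τ in a₀..t, B τ)
          + (1 - γ₀) * ∫ τ in a₀..t,
              C τ * Real.exp ((1 - γ₀) * ∫ s in τ..t, B s)) ^ (1 / (1 - γ₀)) := by
  intro t ht
  have hext (f : ℝ → ℝ) (hf : ContinuousOn f (Set.Icc a₀ b₀))
      (hnn : ∀ t ∈ Set.Icc a₀ b₀, 0 ≤ f t) :
      ∃ g : ℝ → ℝ, Continuous g ∧ (∀ x, 0 ≤ g x) ∧ Set.EqOn f g (Set.Icc a₀ b₀) :=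
    ⟨Set.IccExtend hab.le ((Set.Icc a₀ b₀).domRestrict f), hf.domRestrict.Icc_extend',
      fun _ ↦ hnn _ (Subtype.coe_prop _),
      fun x hx ↦ (Set.IccExtend_of_mem hab.le ((Set.Icc a₀ b₀).domRestrict f) hx).symm⟩
  obtain ⟨B', hB'c, hB'nn, hB⟩ := hext B hBc hBnn
  obtain ⟨C', hC'c, hC'nn, hC⟩ := hext C hCc hCnn
  obtain ⟨F', hF'c, hF'nn, hF⟩ := hext F hFc hFnn
  have hsub {x y : ℝ} (hx : x ∈ Set.Icc a₀ b₀) (hy : y ∈ Set.Icc a₀ b₀) :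
      Set.uIcc x y ⊆ Set.Icc a₀ b₀ := Set.uIcc_subset_Icc hx hy
  have ha : a₀ ∈ Set.Icc a₀ b₀ := ⟨le_rfl, hab.le⟩
  have hB_int {x : ℝ} (hx : x ∈ Set.Icc a₀ b₀) : ∫ s in x..t, B s = ∫ s in x..t, B' s :=
    integral_congr (hB.mono (hsub hx ht))
  have hC_int : ∫ τ in a₀..t, C τ * Real.exp ((1 - γ₀) * ∫ s in τ..t, B s)
      = ∫ τ in a₀..t, C' τ * Real.exp ((1 - γ₀) * ∫ s in τ..t, B' s) :=
    integral_congr fun τ hτ ↦ by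
      simp only [hC (hsub ha ht hτ), hB_int (hsub ha ht hτ)]
  rw [hB_int ha, hC_int, hF ht]
  have hp : 0 < 1 - γ₀ := sub_pos.2 hγ₁
  have hbound (ε : ℝ) (hε : 0 < ε) :=
    perov_sublinear_of_continuous_of_pos (A := A + ε) (by positivity) hγ₀ hγ₁ hB'c hC'c hF'c
      hB'nn hC'nn hF'nn (fun x hx ↦ by
        have h := hineq x hx
        rw [hF hx, integral_congr (g := fun s ↦ B' s * F' s + C' s * F' s ^ γ₀) fun s hs ↦ by
          have hs' := hsub ha hx hs
          simp only [hB hs', hC hs', hF hs']] at h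
        linarith) ht
  have hcont : Continuous fun ε : ℝ ↦
      ((A + ε) ^ (1 - γ₀) * Real.exp ((1 - γ₀) * ∫ τ in a₀..t, B' τ)
        + (1 - γ₀) * ∫ τ in a₀..t, C' τ * Real.exp ((1 - γ₀) * ∫ s in τ..t, B' s))
          ^ (1 / (1 - γ₀)) :=
    ((((continuous_const.add continuous_id).rpow_const fun _ ↦ Or.inr hp.le).mul
      continuous_const).add continuous_const).rpow_const fun _ ↦ Or.inr (by positivity)
  have hlim := (hcont.tendsto 0).mono_left (nhdsWithin_le_nhds (s := Set.Ioi 0))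
  rw [add_zero] at hlim
  exact ge_of_tendsto hlim (Filter.eventually_of_mem self_mem_nhdsWithin hbound)
end

section
/- Let a₀ < b₀ be real numbers, let 𝔄 ≥ 0 be a constant, let 𝔅, ℭ, 𝔉 : [a₀,b₀] → ℝ be nonnegative continuous functions, let γ₀ > 1, and suppose 𝔉(t) ≤ 𝔄 + ∫_{a₀}^t (𝔅(s)𝔉(s) + ℭ(s)𝔉(s)^{γ₀}) ds for all t ∈ [a₀,b₀]. If there exists h ∈ (0, b₀ − a₀] such that 𝔄 · ( (γ₀−1) ∫_{a₀}^{a₀+h} ℭ(τ) dτ )^{1/(γ₀−1)} < ( exp( ∫_{a₀}^{a₀+h} (1−γ₀)𝔅(τ) dτ ) )^{1/(γ₀−1)}, then for all t ∈ [a₀, a₀+h] one has 𝔉(t) ≤ 𝔄 · ( exp( ∫_{a₀}^t (1−γ₀)𝔅(τ) dτ ) − 𝔄^{γ₀−1}(γ₀−1) ∫_{a₀}^t ℭ(τ) · exp( ∫_{τ}^t (1−γ₀)𝔅(s) ds ) dτ )^{1/(1−γ₀)}. -/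
open MeasureTheory intervalIntegral

/-- Perov's inequality for globally continuous data and a positive constant, at a time where the
comparison function has not blown up. -/
theorem le_perov_bound_of_continuous {a t A γ : ℝ} (hat : a ≤ t) (hA : 0 < A) (hγ : 1 < γ)
    {B C F : ℝ → ℝ} (hB : Continuous B) (hC : Continuous C) (hF : Continuous F)
    (hB0 : ∀ s, 0 ≤ B s) (hC0 : ∀ s, 0 ≤ C s) (hF0 : ∀ s, 0 ≤ F s)
    (hle : ∀ r ∈ Set.Icc a t, F r ≤ A + ∫ s in a..r, (B s * F s + C s * F s ^ γ))
    (hpos : 0 < Real.exp (∫ τ in a..t, (1 - γ) * B τ)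
      - A ^ (γ - 1) * (γ - 1) * ∫ τ in a..t, C τ * Real.exp (∫ s in τ..t, (1 - γ) * B s)) :
    F t ≤ A * (Real.exp (∫ τ in a..t, (1 - γ) * B τ)
      - A ^ (γ - 1) * (γ - 1) *
          ∫ τ in a..t, C τ * Real.exp (∫ s in τ..t, (1 - γ) * B s)) ^ (1 / (1 - γ)) := by
  set D := Real.exp (∫ τ in a..t, (1 - γ) * B τ)
      - A ^ (γ - 1) * (γ - 1) * ∫ τ in a..t, C τ * Real.exp (∫ s in τ..t, (1 - γ) * B s) with hD
  have hγ0 : 0 ≤ γ := by linarith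
  set g : ℝ → ℝ := fun s => B s * F s + C s * F s ^ γ with hg
  have hgc : Continuous g :=
    (hB.mul hF).add (hC.mul (hF.rpow_const fun _ => Or.inr hγ0))
  set G : ℝ → ℝ := fun r => A + ∫ s in a..r, g s with hGdef
  have hGd : ∀ r, HasDerivAt G (g r) r := fun r =>
    (hgc.integral_hasStrictDerivAt a r).hasDerivAt.const_add A
  have hg0 : ∀ s, 0 ≤ g s := fun s =>
    add_nonneg (mul_nonneg (hB0 s) (hF0 s)) (mul_nonneg (hC0 s) (Real.rpow_nonneg (hF0 s) _))
  have hGA : ∀ r ∈ Set.Icc a t, A ≤ G r := fun r hr =>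
    le_add_of_nonneg_right (integral_nonneg hr.1 fun s _ => hg0 s)
  have hEc : Continuous fun s => (1 - γ) * B s := continuous_const.mul hB
  set E : ℝ → ℝ := fun r => Real.exp (∫ s in r..t, (1 - γ) * B s) with hE
  have hEd : ∀ r, HasDerivAt E (E r * (-((1 - γ) * B r))) r := fun r =>
    (integral_hasDerivAt_left (hEc.intervalIntegrable _ _)
      (hEc.stronglyMeasurableAtFilter _ _) hEc.continuousAt).exp
  have hEcont : Continuous E := continuous_iff_continuousAt.2 fun r => (hEd r).continuousAt
  have hCE : Continuous fun s => C s * E s := hC.mul hEcont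
  set H : ℝ → ℝ := fun r => G r ^ (1 - γ) * E r + (γ - 1) * ∫ s in a..r, C s * E s with hH
  have hHd : ∀ r ∈ Set.Icc a t, HasDerivAt H
      (g r * (1 - γ) * G r ^ (1 - γ - 1) * E r + G r ^ (1 - γ) * (E r * (-((1 - γ) * B r)))
        + (γ - 1) * (C r * E r)) r := fun r hr =>
    (((hGd r).rpow_const (Or.inl (hA.trans_le (hGA r hr)).ne')).mul (hEd r)).add
      ((hCE.integral_hasStrictDerivAt a r).hasDerivAt.const_mul (γ - 1))
  have hmono : MonotoneOn H (Set.Icc a t) := by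
    refine monotoneOn_of_hasDerivWithinAt_nonneg (convex_Icc a t)
      (fun r hr => (hHd r hr).continuousAt.continuousWithinAt)
      (fun r hr => (hHd r (interior_subset hr)).hasDerivWithinAt) fun r hr => ?_
    have hr' := interior_subset hr
    have hG0 : 0 < G r := hA.trans_le (hGA r hr')
    have hFG : F r ≤ G r := hle r hr'
    have h1 : g r ≤ B r * G r + C r * G r ^ γ :=
      add_le_add (mul_le_mul_of_nonneg_left hFG (hB0 r))
        (mul_le_mul_of_nonneg_left (Real.rpow_le_rpow (hF0 r) hFG hγ0) (hC0 r))
    have e1 : G r * G r ^ (1 - γ - 1) = G r ^ (1 - γ) := by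
      rw [← Real.rpow_one_add' hG0.le (by linarith)]; congr 1; ring
    have e2 : G r ^ γ * G r ^ (1 - γ - 1) = 1 := by
      rw [← Real.rpow_add hG0, show γ + (1 - γ - 1) = 0 by ring, Real.rpow_zero]
    have hP : 0 ≤ (γ - 1) * G r ^ (1 - γ - 1) * E r :=
      mul_nonneg (mul_nonneg (by linarith) (Real.rpow_nonneg hG0.le _)) (Real.exp_pos _).le
    have h2 := mul_le_mul_of_nonneg_left h1 hP
    have h3 : (γ - 1) * G r ^ (1 - γ - 1) * E r * (B r * G r + C r * G r ^ γ)
        = (γ - 1) * E r * B r * G r ^ (1 - γ) + (γ - 1) * E r * C r := by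
      rw [← e1]
      linear_combination (γ - 1) * E r * C r * e2
    linarith
  have hend := hmono (Set.left_mem_Icc.2 hat) (Set.right_mem_Icc.2 hat) hat
  have hGa : G a = A := by simp [hGdef]
  have hEt : E t = 1 := by simp [hE]
  have hHa : H a = A ^ (1 - γ) * E a := by simp [hH, hGa]
  have hHt : H t = G t ^ (1 - γ) + (γ - 1) * ∫ s in a..t, C s * E s := by simp [hH, hEt]
  have hAA : A ^ (1 - γ) * A ^ (γ - 1) = 1 := by
    rw [← Real.rpow_add hA, show 1 - γ + (γ - 1) = 0 by ring, Real.rpow_zero]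
  have hAD : A ^ (1 - γ) * D ≤ G t ^ (1 - γ) := by
    have : A ^ (1 - γ) * D = A ^ (1 - γ) * E a - (γ - 1) * ∫ s in a..t, C s * E s := by
      rw [hD]
      linear_combination (-(γ - 1) * ∫ s in a..t, C s * E s) * hAA
    linarith
  have hGt : 0 < G t := hA.trans_le (hGA t (Set.right_mem_Icc.2 hat))
  have hγ1 : 1 - γ ≠ 0 := by linarith
  calc F t ≤ G t := hle t (Set.right_mem_Icc.2 hat)
    _ = (G t ^ (1 - γ)) ^ (1 / (1 - γ)) := by
      rw [one_div, Real.rpow_rpow_inv hGt.le hγ1]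
    _ ≤ (A ^ (1 - γ) * D) ^ (1 / (1 - γ)) :=
      Real.rpow_le_rpow_of_nonpos (mul_pos (Real.rpow_pos_of_pos hA _) hpos) hAD
        (one_div_nonpos.2 (by linarith))
    _ = A * D ^ (1 / (1 - γ)) := by
      rw [Real.mul_rpow (Real.rpow_nonneg hA.le _) hpos.le, one_div,
        Real.rpow_rpow_inv hA.le hγ1]

/-- A nonnegative continuous function on `[a, b]` extends to one on the real line. -/
theorem exists_continuous_nonneg_eqOn_Icc {a b : ℝ} (hab : a ≤ b) {f : ℝ → ℝ}
    (hf : ContinuousOn f (Set.Icc a b)) (hf0 : ∀ t ∈ Set.Icc a b, 0 ≤ f t) :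
    ∃ g : ℝ → ℝ, Continuous g ∧ (∀ t, 0 ≤ g t) ∧ Set.EqOn g f (Set.Icc a b) :=
  ⟨Set.IccExtend hab ((Set.Icc a b).domRestrict f), hf.domRestrict.Icc_extend',
    fun t => hf0 _ (Set.projIcc a b hab t).2, fun _ ht => Set.IccExtend_of_mem hab _ ht⟩

/-- Perov's generalization of the Gronwall lemma, superlinear case `γ₀ > 1`. -/
theorem perov_gronwall_superlinear
    (a₀ b₀ : ℝ) (hab : a₀ < b₀)
    (A γ₀ : ℝ) (hA : 0 ≤ A) (hγ : 1 < γ₀)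
    (B C F : ℝ → ℝ)
    (hBc : ContinuousOn B (Set.Icc a₀ b₀))
    (hCc : ContinuousOn C (Set.Icc a₀ b₀))
    (hFc : ContinuousOn F (Set.Icc a₀ b₀))
    (hBnn : ∀ t ∈ Set.Icc a₀ b₀, 0 ≤ B t)
    (hCnn : ∀ t ∈ Set.Icc a₀ b₀, 0 ≤ C t)
    (hFnn : ∀ t ∈ Set.Icc a₀ b₀, 0 ≤ F t)
    (hineq : ∀ t ∈ Set.Icc a₀ b₀,
      F t ≤ A + ∫ s in a₀..t, (B s * F s + C s * F s ^ γ₀))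
    (h : ℝ) (hh0 : 0 < h) (hhb : h ≤ b₀ - a₀)
    (hsmall : A * ((γ₀ - 1) * ∫ τ in a₀..(a₀ + h), C τ) ^ (1 / (γ₀ - 1))
      < (Real.exp (∫ τ in a₀..(a₀ + h), (1 - γ₀) * B τ)) ^ (1 / (γ₀ - 1))) :
    ∀ t ∈ Set.Icc a₀ (a₀ + h),
      F t ≤ A * (Real.exp (∫ τ in a₀..t, (1 - γ₀) * B τ)
          - A ^ (γ₀ - 1) * (γ₀ - 1) *
              ∫ τ in a₀..t, C τ * Real.exp (∫ s in τ..t, (1 - γ₀) * B s)) ^ (1 / (1 - γ₀)) := by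
  obtain ⟨B', hB, hB0, hBB⟩ := exists_continuous_nonneg_eqOn_Icc hab.le hBc hBnn
  obtain ⟨C', hC, hC0, hCC⟩ := exists_continuous_nonneg_eqOn_Icc hab.le hCc hCnn
  obtain ⟨F', hF, hF0, hFF⟩ := exists_continuous_nonneg_eqOn_Icc hab.le hFc hFnn
  intro t ht
  have hh : a₀ + h ∈ Set.Icc a₀ b₀ := ⟨by linarith, by linarith⟩
  have ht' : t ∈ Set.Icc a₀ b₀ := ⟨ht.1, ht.2.trans hh.2⟩
  have ha : a₀ ∈ Set.Icc a₀ b₀ := Set.left_mem_Icc.2 hab.le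
  have intB : ∀ x ∈ Set.Icc a₀ b₀, ∀ y ∈ Set.Icc a₀ b₀,
      ∫ s in x..y, (1 - γ₀) * B s = ∫ s in x..y, (1 - γ₀) * B' s := fun x hx y hy =>
    integral_congr fun s hs => by simp only [hBB (Set.uIcc_subset_Icc hx hy hs)]
  have intC : ∫ τ in a₀..(a₀ + h), C τ = ∫ τ in a₀..(a₀ + h), C' τ :=
    integral_congr fun s hs => by simp only [hCC (Set.uIcc_subset_Icc ha hh hs)]
  have intCE : ∫ τ in a₀..t, C τ * Real.exp (∫ s in τ..t, (1 - γ₀) * B s)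
      = ∫ τ in a₀..t, C' τ * Real.exp (∫ s in τ..t, (1 - γ₀) * B' s) :=
    integral_congr fun s hs => by
      have hs' := Set.uIcc_subset_Icc ha ht' hs
      simp only [hCC hs', intB s hs' t ht']
  have hle : ∀ r ∈ Set.Icc a₀ t,
      F' r ≤ A + ∫ s in a₀..r, (B' s * F' s + C' s * F' s ^ γ₀) := fun r hr => by
    have hr' : r ∈ Set.Icc a₀ b₀ := ⟨hr.1, hr.2.trans ht'.2⟩
    have : ∫ s in a₀..r, (B' s * F' s + C' s * F' s ^ γ₀)
        = ∫ s in a₀..r, (B s * F s + C s * F s ^ γ₀) :=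
      integral_congr fun s hs => by
        have hs' := Set.uIcc_subset_Icc ha hr' hs
        simp only [hBB hs', hCC hs', hFF hs']
    rw [this, hFF hr']
    exact hineq r hr'
  rw [intC, intB a₀ ha _ hh] at hsmall
  rw [intCE, intB a₀ ha t ht', ← hFF ht']
  have hp : 0 < γ₀ - 1 := by linarith
  have hEc : Continuous fun s => (1 - γ₀) * B' s := continuous_const.mul hB
  have hexp_le : ∀ x y, x ≤ y → Real.exp (∫ s in x..y, (1 - γ₀) * B' s) ≤ 1 := fun x y hxy =>
    by
    rw [Real.exp_le_one_iff, intervalIntegral.integral_const_mul]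
    exact mul_nonpos_of_nonpos_of_nonneg (by linarith) (integral_nonneg hxy fun s _ => hB0 s)
  rcases hA.eq_or_lt with rfl | hA
  · -- perturb the constant: the bounds for `ε > 0` tend to `0` as `ε → 0`
    rw [zero_mul]
    set e := Real.exp (∫ τ in a₀..t, (1 - γ₀) * B' τ) with he
    set I := ∫ τ in a₀..t, C' τ * Real.exp (∫ s in τ..t, (1 - γ₀) * B' s) with hI
    have hD : ContinuousAt (fun ε : ℝ => e - ε ^ (γ₀ - 1) * (γ₀ - 1) * I) 0 :=
      continuousAt_const.sub <| ((Real.continuousAt_rpow_const 0 _ (Or.inr hp.le)).mul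
        continuousAt_const).mul continuousAt_const
    have hD0 : 0 < (fun ε : ℝ => e - ε ^ (γ₀ - 1) * (γ₀ - 1) * I) 0 := by
      simp [Real.zero_rpow hp.ne', he, Real.exp_pos]
    have hlim : ContinuousAt
        (fun ε : ℝ => ε * (e - ε ^ (γ₀ - 1) * (γ₀ - 1) * I) ^ (1 / (1 - γ₀))) 0 :=
      continuousAt_id.mul (hD.rpow_const (Or.inl hD0.ne'))
    have hlim' := hlim.tendsto
    rw [zero_mul] at hlim'
    refine ge_of_tendsto (hlim'.mono_left (nhdsWithin_le_nhds (s := Set.Ioi 0))) ?_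
    filter_upwards [nhdsWithin_le_nhds (hD.eventually (lt_mem_nhds hD0)), self_mem_nhdsWithin]
      with ε hε hε0
    exact le_perov_bound_of_continuous ht.1 hε0 hγ hB hC hF hB0 hC0 hF0
      (fun r hr => (hle r hr).trans (by gcongr; exact le_of_lt hε0)) hε
  · refine le_perov_bound_of_continuous ht.1 hA hγ hB hC hF hB0 hC0 hF0 hle (sub_pos.2 ?_)
    have hEcont : Continuous fun τ => Real.exp (∫ s in τ..t, (1 - γ₀) * B' s) := by
      refine Real.continuous_exp.comp ?_
      simp_rw [integral_symm t]
      exact (continuous_primitive (fun _ _ => hEc.intervalIntegrable _ _) t).neg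
    have hI1 : ∫ τ in a₀..t, C' τ * Real.exp (∫ s in τ..t, (1 - γ₀) * B' s)
        ≤ ∫ τ in a₀..t, C' τ :=
      integral_mono_on ht.1 ((hC.mul hEcont).intervalIntegrable _ _) (hC.intervalIntegrable _ _)
        fun s hs => mul_le_of_le_one_right (hC0 s) (hexp_le s t hs.2)
    have hI2 : ∫ τ in a₀..t, C' τ ≤ ∫ τ in a₀..(a₀ + h), C' τ := by
      rw [← integral_add_adjacent_intervals (hC.intervalIntegrable a₀ t)
        (hC.intervalIntegrable t (a₀ + h))]
      exact le_add_of_nonneg_right (integral_nonneg ht.2 fun s _ => hC0 s)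
    have hI0 : 0 ≤ ∫ τ in a₀..(a₀ + h), C' τ := integral_nonneg hh.1 fun s _ => hC0 s
    have hE : Real.exp (∫ τ in a₀..(a₀ + h), (1 - γ₀) * B' τ)
        ≤ Real.exp (∫ τ in a₀..t, (1 - γ₀) * B' τ) := by
      rw [← integral_add_adjacent_intervals (hEc.intervalIntegrable a₀ t)
        (hEc.intervalIntegrable t (a₀ + h)), Real.exp_add]
      exact mul_le_of_le_one_right (Real.exp_pos _).le (hexp_le _ _ ht.2)
    have hpow := Real.rpow_lt_rpow
      (mul_nonneg hA.le (Real.rpow_nonneg (mul_nonneg hp.le hI0) _)) hsmall hp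
    rw [Real.mul_rpow hA.le (Real.rpow_nonneg (mul_nonneg hp.le hI0) _), one_div,
      Real.rpow_inv_rpow (mul_nonneg hp.le hI0) hp.ne',
      Real.rpow_inv_rpow (Real.exp_pos _).le hp.ne', ← mul_assoc] at hpow
    exact (mul_le_mul_of_nonneg_left (hI1.trans hI2)
      (mul_nonneg (Real.rpow_nonneg hA.le _) hp.le)).trans_lt (hpow.trans_le hE)
end
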